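/- Assume φ is intrinsically differentiable at a point w_0 ∈ U, with intrinsic gradient ∇^φφ(w_0) ∈ ℝ^{m−1}. Then: (i) for every j = 2,…,m and every C^1 curve γ : [0,T] → U with γ(0) = w_0 and γ'(t) = D^φ_j|_{γ(t)}, the function t ↦ φ(γ(t)) is differentiable from the right at 0 with derivative equal to the j-th component (∇^φφ(w_0))_j; and (ii) for every i = 1,…,h, lim_{t→0^+} |φ(w_0 + t e_{y_i}) − φ(w_0)|/t^{1/2} = 0, where e_{y_i} is the unit vector in the y_i-direction (for t small enough that w_0 + t e_{y_i} ∈ U). -/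

import Mathlib

open MeasureTheory Filter Topology

namespace Step2

/-- The underlying space of the step-2 Carnot group `G = ℝ^m × ℝ^h`. -/
abbrev G (m h : ℕ) := (Fin m → ℝ) × (Fin h → ℝ)

variable {m h : ℕ}

/-- Group product `(x,y)·(x',y') = (x+x', y+y' - (1/2)⟨Bx,x'⟩)`. -/
noncomputable def gmul (B : Fin h → Matrix (Fin m) (Fin m) ℝ) (p q : G m h) : G m h :=
  (p.1 + q.1, fun i => p.2 i + q.2 i - (1 / 2) * ∑ j, ∑ k, B i j k * p.1 k * q.1 j)

/-- Group inverse `g⁻¹ = -g`. -/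
def ginv (p : G m h) : G m h := (-p.1, -p.2)

/-- Homogeneous norm `‖(x,y)‖ = Σ|x_j| + Σ|y_i|^(1/2)`. -/
noncomputable def hnorm (p : G m h) : ℝ :=
  (∑ j, |p.1 j|) + ∑ i, Real.sqrt |p.2 i|

/-- Homogeneous (quasi-)distance `d(p,q) = ‖p⁻¹·q‖`. -/
noncomputable def gdist (B : Fin h → Matrix (Fin m) (Fin m) ℝ) (p q : G m h) : ℝ :=
  hnorm (gmul B (ginv p) q)

/-- Euclidean distance on `G`. -/
noncomputable def eDist (p q : G m h) : ℝ :=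
  Real.sqrt ((∑ j, (p.1 j - q.1 j) ^ 2) + ∑ i, (p.2 i - q.2 i) ^ 2)

/-- The subgroup `W = {x_1 = 0}`. -/
def Wset (m h : ℕ) [NeZero m] : Set (G m h) := {p | p.1 0 = 0}

/-- `U` is (relatively) open in `W`. -/
def RelOpen (m h : ℕ) [NeZero m] (U : Set (G m h)) : Prop :=
  ∃ O : Set (G m h), IsOpen O ∧ U = O ∩ Wset m h

/-- The graphing map `Φ(w) = (φ(w),0,…,0) ∈ L`. -/
noncomputable def Phi [NeZero m] (φ : G m h → ℝ) (w : G m h) : G m h :=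
  ((fun j => if j = 0 then φ w else 0), 0)

/-- Horizontal coordinate vector `e_{x_j}`. -/
def eH (m h : ℕ) (j : Fin m) : G m h := ((fun j' => if j' = j then 1 else 0), 0)

/-- Vertical coordinate vector `e_{y_i}`. -/
def eV (m h : ℕ) (i : Fin h) : G m h := (0, fun i' => if i' = i then 1 else 0)

/-- The projected vector field `D^φ_j` (for `j ≠ 0`, i.e. `j = 2,…,m` in 1-based indexing):
`D^φ_j|_w = ∂_{x_j} - Σ_i ( b^(i)_{j1} φ(w) + (1/2) Σ_{k≥2} x_k b^(i)_{jk} ) ∂_{y_i}`. -/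
noncomputable def Dvec [NeZero m] (B : Fin h → Matrix (Fin m) (Fin m) ℝ)
    (φ : G m h → ℝ) (j : Fin m) (w : G m h) : G m h :=
  ((fun j' => if j' = j then 1 else 0),
   fun i => -(B i j 0 * φ w
      + (1 / 2) * ∑ k ∈ Finset.univ.erase (0 : Fin m), w.1 k * B i j k))

/-- `D^φφ = ω` in the broad* sense on `U`. -/
def IsBroadStar [NeZero m] (B : Fin h → Matrix (Fin m) (Fin m) ℝ) (U : Set (G m h))
    (φ : G m h → ℝ) (ω : G m h → Fin m → ℝ) : Prop :=
  ∀ a₀ ∈ U, ∃ δ₁ δ₂ : ℝ, 0 < δ₂ ∧ δ₂ < δ₁ ∧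
    ∀ j : Fin m, j ≠ 0 → ∃ E : G m h → ℝ → G m h,
      ∀ a, a ∈ U → eDist a a₀ ≤ δ₂ →
        (∀ t ∈ Set.Icc (-δ₂) δ₂, E a t ∈ U ∧ eDist (E a t) a₀ ≤ δ₁) ∧
        E a 0 = a ∧
        (∀ t ∈ Set.Icc (-δ₂) δ₂,
          HasDerivWithinAt (E a) (Dvec B φ j (E a t)) (Set.Icc (-δ₂) δ₂) t) ∧
        (∀ t ∈ Set.Icc (-δ₂) δ₂, φ (E a t) - φ a = ∫ s in (0:ℝ)..t, ω (E a s) j)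

/-- `φ` is vertically broad* Hölder on `U`. -/
def VertHolder (m h : ℕ) [NeZero m] (U : Set (G m h)) (φ : G m h → ℝ) : Prop :=
  ∀ a₀ ∈ U, ∃ U' : Set (G m h), RelOpen m h U' ∧ a₀ ∈ U' ∧
    IsCompact (closure U') ∧ closure U' ⊆ U ∧
    ∀ i : Fin h, ∀ ε > (0:ℝ), ∃ ρ > (0:ℝ), ∀ p ∈ U', ∀ q ∈ U',
      p.1 = q.1 → (∀ i' : Fin h, i' ≠ i → p.2 i' = q.2 i') →
      0 < |p.2 i - q.2 i| → |p.2 i - q.2 i| ≤ ρ →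
      |φ p - φ q| ≤ ε * Real.sqrt |p.2 i - q.2 i|

/-- The translated point `Φ(a)⁻¹·a⁻¹·b·Φ(a)`. -/
noncomputable def shiftQ [NeZero m] (B : Fin h → Matrix (Fin m) (Fin m) ℝ)
    (φ : G m h → ℝ) (a b : G m h) : G m h :=
  gmul B (gmul B (gmul B (ginv (Phi φ a)) (ginv a)) b) (Phi φ a)

/-- `φ` is intrinsically differentiable at `a₀` with intrinsic gradient `grad`. -/
def IDAt [NeZero m] (B : Fin h → Matrix (Fin m) (Fin m) ℝ) (U : Set (G m h))
    (φ : G m h → ℝ) (a₀ : G m h) (grad : Fin m → ℝ) : Prop :=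
  ∀ ε > (0:ℝ), ∃ r > (0:ℝ), ∀ b ∈ U, 0 < gdist B a₀ b → gdist B a₀ b < r →
    |φ b - φ a₀ - ∑ j ∈ Finset.univ.erase (0 : Fin m), grad j * (b.1 j - a₀.1 j)|
      ≤ ε * hnorm (shiftQ B φ a₀ b)

/-- `φ` is uniformly intrinsically differentiable at `a₀` with intrinsic gradient `grad`. -/
def UIDAt [NeZero m] (B : Fin h → Matrix (Fin m) (Fin m) ℝ) (U : Set (G m h))
    (φ : G m h → ℝ) (a₀ : G m h) (grad : Fin m → ℝ) : Prop :=
  ∀ ε > (0:ℝ), ∃ r > (0:ℝ), ∀ a ∈ U, ∀ b ∈ U,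
    gdist B a₀ a < r → gdist B a₀ b < r → a ≠ b →
    |φ b - φ a - ∑ j ∈ Finset.univ.erase (0 : Fin m), grad j * (b.1 j - a.1 j)|
      ≤ ε * hnorm (shiftQ B φ a b)

/-- Projection onto `L` in the splitting `G = W·L`. -/
def piL (m h : ℕ) [NeZero m] (g : G m h) : G m h :=
  ((fun j => if j = 0 then g.1 0 else 0), 0)

/-- Projection onto `W` in the splitting `G = W·L`. -/
noncomputable def piW [NeZero m] (B : Fin h → Matrix (Fin m) (Fin m) ℝ) (g : G m h) : G m h :=
  ((fun j => if j = 0 then 0 else g.1 j),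
   fun i => g.2 i + (1 / 2) * g.1 0 * ∑ k ∈ Finset.univ.erase (0 : Fin m), B i 0 k * g.1 k)

/-- Coordinates `ℝ^(m-1) × ℝ^h → W ⊆ G`. -/
def emb (m h : ℕ) (u : (Fin (m - 1) → ℝ) × (Fin h → ℝ)) : G m h :=
  ((fun j => if hj : (j : ℕ) = 0 then 0
      else u.1 ⟨(j : ℕ) - 1, by have := j.isLt; omega⟩), u.2)

/-- The Lebesgue measure on `W`, as a measure on `G`. -/
noncomputable def muW (m h : ℕ) : Measure (G m h) :=
  Measure.map (emb m h) volume

end Step2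

namespace Step2

section Lemmas

variable {m h : ℕ}

open Matrix in
/-- The vertical part of the group law, as a matrix bilinear form. -/
theorem gmul_snd (B : Fin h → Matrix (Fin m) (Fin m) ℝ) (p q : G m h) (i : Fin h) :
    (gmul B p q).2 i = p.2 i + q.2 i - (1 / 2) * (q.1 ⬝ᵥ (B i *ᵥ p.1)) := by
  simp only [gmul, dotProduct, mulVec, Finset.mul_sum]
  congr 1
  refine Finset.sum_congr rfl fun j _ => Finset.sum_congr rfl fun k _ => ?_
  ring

open Matrix in
theorem dotProduct_mulVec_skew {A : Matrix (Fin m) (Fin m) ℝ} (hA : A.transpose = -A)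
    (x y : Fin m → ℝ) : x ⬝ᵥ (A *ᵥ y) = -(y ⬝ᵥ (A *ᵥ x)) := by
  rw [dotProduct_mulVec, ← mulVec_transpose, hA, neg_mulVec, neg_dotProduct, dotProduct_comm]

open Matrix in
theorem dotProduct_mulVec_skew_self {A : Matrix (Fin m) (Fin m) ℝ} (hA : A.transpose = -A)
    (x : Fin m → ℝ) : x ⬝ᵥ (A *ᵥ x) = 0 := by
  linarith [dotProduct_mulVec_skew hA x x]

theorem shiftQ_fst [NeZero m] (B : Fin h → Matrix (Fin m) (Fin m) ℝ) (φ : G m h → ℝ)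
    (a b : G m h) : (shiftQ B φ a b).1 = b.1 - a.1 := by
  simp only [shiftQ, gmul, ginv]
  abel

open Matrix in
theorem shiftQ_snd [NeZero m] {B : Fin h → Matrix (Fin m) (Fin m) ℝ}
    (hskew : ∀ i, (B i).transpose = - B i) (φ : G m h → ℝ) (a b : G m h) (i : Fin h) :
    (shiftQ B φ a b).2 i = b.2 i - a.2 i + (b.1 - a.1) ⬝ᵥ (B i *ᵥ (Phi φ a).1)
      + (1 / 2) * (b.1 ⬝ᵥ (B i *ᵥ a.1)) := by
  have hP : (Phi φ a).2 i = 0 := rfl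
  simp only [shiftQ, gmul_snd, hP]
  simp only [gmul, ginv, Pi.neg_apply, hP, mulVec_add, mulVec_neg, dotProduct_add, dotProduct_neg,
    neg_dotProduct, sub_dotProduct]
  linarith [dotProduct_mulVec_skew (hskew i) (Phi φ a).1 a.1,
    dotProduct_mulVec_skew (hskew i) (Phi φ a).1 b.1,
    dotProduct_mulVec_skew_self (hskew i) (Phi φ a).1]

theorem continuous_gdist (B : Fin h → Matrix (Fin m) (Fin m) ℝ) (a : G m h) :
    Continuous (gdist B a) := by
  unfold gdist hnorm gmul
  fun_prop

open Matrix in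
theorem gdist_self {B : Fin h → Matrix (Fin m) (Fin m) ℝ}
    (hskew : ∀ i, (B i).transpose = - B i) (a : G m h) : gdist B a a = 0 := by
  unfold gdist hnorm
  simp only [gmul_snd]
  simp [ginv, gmul, mulVec_neg, dotProduct_mulVec_skew_self (hskew _)]

theorem abs_fst_sub_le_gdist (B : Fin h → Matrix (Fin m) (Fin m) ℝ) (a b : G m h) (j : Fin m) :
    |b.1 j - a.1 j| ≤ gdist B a b := by
  have h1 : |b.1 j - a.1 j| = |(gmul B (ginv a) b).1 j| := by
    simp only [gmul, ginv, Pi.add_apply, Pi.neg_apply]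
    congr 1
    ring
  rw [h1]
  have h2 := Finset.single_le_sum (f := fun j => |(gmul B (ginv a) b).1 j|)
    (fun j _ => abs_nonneg _) (Finset.mem_univ j)
  have h3 : 0 ≤ ∑ i, Real.sqrt |(gmul B (ginv a) b).2 i| :=
    Finset.sum_nonneg fun i _ => Real.sqrt_nonneg _
  exact h2.trans (le_add_of_nonneg_right h3)

open Matrix in
/-- Along a vertical segment both the shifted point and the distance are explicit. -/
theorem hnorm_shiftQ_vertical [NeZero m] {B : Fin h → Matrix (Fin m) (Fin m) ℝ}
    (hskew : ∀ i, (B i).transpose = - B i) (φ : G m h → ℝ) (a : G m h) (i : Fin h) {t : ℝ}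
    (ht : 0 ≤ t) : hnorm (shiftQ B φ a (a + t • eV m h i)) = Real.sqrt t := by
  unfold hnorm
  simp only [shiftQ_fst, shiftQ_snd hskew]
  simp [eV, dotProduct_mulVec_skew_self (hskew _), apply_ite abs, apply_ite Real.sqrt,
    abs_of_nonneg ht]

open Matrix in
theorem gdist_vertical {B : Fin h → Matrix (Fin m) (Fin m) ℝ}
    (hskew : ∀ i, (B i).transpose = - B i) (a : G m h) (i : Fin h) {t : ℝ}
    (ht : 0 ≤ t) : gdist B a (a + t • eV m h i) = Real.sqrt t := by
  unfold gdist hnorm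
  simp only [gmul_snd]
  simp [gmul, ginv, eV, mulVec_neg, dotProduct_mulVec_skew_self (hskew _), apply_ite abs,
    apply_ite Real.sqrt, abs_of_nonneg ht]

theorem fst_integralCurve [NeZero m] {B : Fin h → Matrix (Fin m) (Fin m) ℝ} {φ : G m h → ℝ}
    {j : Fin m} {T : ℝ} {γ : ℝ → G m h}
    (hγ : ∀ t ∈ Set.Icc (0:ℝ) T,
      HasDerivWithinAt γ (Dvec B φ j (γ t)) (Set.Icc (0:ℝ) T) t)
    {t : ℝ} (ht : t ∈ Set.Icc (0:ℝ) T) :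
    (γ t).1 = (γ 0).1 + t • Pi.single j 1 := by
  ext k
  have hd : ∀ s ∈ Set.Icc (0:ℝ) T, HasDerivWithinAt
      (fun s => (γ s).1 k - s * (Pi.single j 1 : Fin m → ℝ) k) 0 (Set.Icc (0:ℝ) T) s := by
    intro s hs
    have h1 := hasDerivWithinAt_pi.1 (hγ s hs).fst k
    have h2 := h1.sub ((hasDerivWithinAt_id s (Set.Icc (0:ℝ) T)).mul_const
      ((Pi.single j 1 : Fin m → ℝ) k))
    refine h2.congr_deriv ?_
    simp [Dvec, Pi.single_apply]
  have := (convex_Icc (0:ℝ) T).norm_image_sub_le_of_norm_hasDerivWithin_le (C := 0) hd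
    (fun s _ => by simp) (Set.left_mem_Icc.2 (ht.1.trans ht.2)) ht
  simp only [zero_mul, norm_le_zero_iff] at this
  simp only [Pi.add_apply, Pi.smul_apply, smul_eq_mul]
  linarith

open Matrix in
theorem abs_shiftQ_snd_integralCurve_le [NeZero m] {B : Fin h → Matrix (Fin m) (Fin m) ℝ}
    (hskew : ∀ i, (B i).transpose = - B i) {φ : G m h → ℝ}
    {j : Fin m} {T : ℝ} {γ : ℝ → G m h} (hW : γ 0 ∈ Wset m h)
    (hγ : ∀ t ∈ Set.Icc (0:ℝ) T,
      HasDerivWithinAt γ (Dvec B φ j (γ t)) (Set.Icc (0:ℝ) T) t)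
    {t M : ℝ} (ht : t ∈ Set.Icc (0:ℝ) T)
    (hM : ∀ s ∈ Set.Icc (0:ℝ) t, |φ (γ s) - φ (γ 0)| ≤ M) (i : Fin h) :
    |(shiftQ B φ (γ 0) (γ t)).2 i| ≤ |B i j 0| * (M * t) := by
  have hsub : Set.Icc (0:ℝ) t ⊆ Set.Icc 0 T := Set.Icc_subset_Icc_right ht.2
  have hPhi : (Phi φ (γ 0)).1 = φ (γ 0) • (Pi.single 0 1 : Fin m → ℝ) := by
    ext k
    simp [Phi, Pi.single_apply]
  have hq : ∀ s ∈ Set.Icc (0:ℝ) T, (shiftQ B φ (γ 0) (γ s)).2 i =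
      (γ s).2 i - (γ 0).2 i + s * (B i j 0 * φ (γ 0) + (1 / 2) * (B i *ᵥ (γ 0).1) j) := by
    intro s hs
    rw [shiftQ_snd hskew, hPhi, fst_integralCurve hγ hs]
    simp [mulVec_smul, add_dotProduct, dotProduct_mulVec_skew_self (hskew i)]
    ring
  have hjj : B i j j = 0 := by
    have := congrFun (congrFun (hskew i) j) j
    rw [transpose_apply, Matrix.neg_apply] at this
    linarith
  have hsum : ∀ s ∈ Set.Icc (0:ℝ) T,
      ∑ k ∈ Finset.univ.erase (0 : Fin m), (γ s).1 k * B i j k = (B i *ᵥ (γ 0).1) j := by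
    intro s hs
    have h0 : (γ 0).1 0 = 0 := hW
    have h1 : (B i *ᵥ (γ 0).1) j =
        ∑ k ∈ Finset.univ.erase (0 : Fin m), (γ 0).1 k * B i j k := by
      simp only [mulVec, dotProduct]
      rw [← Finset.add_sum_erase _ _ (Finset.mem_univ (0 : Fin m)), h0, mul_zero, zero_add]
      exact Finset.sum_congr rfl fun k _ => mul_comm _ _
    rw [h1]
    refine Finset.sum_congr rfl fun k _ => ?_
    rw [fst_integralCurve hγ hs]
    by_cases hk : k = j
    · simp [hk, hjj]
    · simp [hk]
  have hd : ∀ s ∈ Set.Icc (0:ℝ) t, HasDerivWithinAt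
      (fun s => (γ s).2 i - (γ 0).2 i
        + s * (B i j 0 * φ (γ 0) + (1 / 2) * (B i *ᵥ (γ 0).1) j))
      (-(B i j 0) * (φ (γ s) - φ (γ 0))) (Set.Icc (0:ℝ) t) s := by
    intro s hs
    have h1 := hasDerivWithinAt_pi.1 ((hγ s (hsub hs)).mono hsub).snd i
    have h2 := (h1.sub_const ((γ 0).2 i)).add
      ((hasDerivWithinAt_id s (Set.Icc (0:ℝ) t)).mul_const
        (B i j 0 * φ (γ 0) + (1 / 2) * (B i *ᵥ (γ 0).1) j))
    refine h2.congr_deriv ?_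
    simp only [Dvec, hsum s (hsub hs)]
    ring
  have := (convex_Icc (0:ℝ) t).norm_image_sub_le_of_norm_hasDerivWithin_le
    (C := |B i j 0| * M) hd
    (fun s hs => by
      rw [Real.norm_eq_abs, abs_mul, abs_neg]
      exact mul_le_mul_of_nonneg_left (hM s hs) (abs_nonneg _))
    (Set.left_mem_Icc.2 ht.1) (Set.right_mem_Icc.2 ht.1)
  rw [hq t ht]
  simpa [abs_of_nonneg ht.1, mul_assoc] using this

theorem hnorm_shiftQ_integralCurve_le [NeZero m] {B : Fin h → Matrix (Fin m) (Fin m) ℝ}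
    (hskew : ∀ i, (B i).transpose = - B i) {φ : G m h → ℝ}
    {j : Fin m} {T : ℝ} {γ : ℝ → G m h} (hW : γ 0 ∈ Wset m h)
    (hγ : ∀ t ∈ Set.Icc (0:ℝ) T,
      HasDerivWithinAt γ (Dvec B φ j (γ t)) (Set.Icc (0:ℝ) T) t)
    {t M : ℝ} (ht : t ∈ Set.Icc (0:ℝ) T)
    (hM : ∀ s ∈ Set.Icc (0:ℝ) t, |φ (γ s) - φ (γ 0)| ≤ M) :
    hnorm (shiftQ B φ (γ 0) (γ t)) ≤ t + (∑ i, Real.sqrt |B i j 0|) * Real.sqrt (M * t) := by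
  unfold hnorm
  refine add_le_add (le_of_eq ?_) ?_
  · rw [shiftQ_fst, fst_integralCurve hγ ht]
    simp [Pi.single_apply, abs_of_nonneg ht.1, apply_ite abs]
  · rw [Finset.sum_mul]
    refine Finset.sum_le_sum fun i _ => ?_
    rw [← Real.sqrt_mul (abs_nonneg _)]
    exact Real.sqrt_le_sqrt (abs_shiftQ_snd_integralCurve_le hskew hW hγ ht hM i)

/-- The approximation that intrinsic differentiability gives along an integral curve. -/
theorem IDAt.eventually_integralCurve [NeZero m] {B : Fin h → Matrix (Fin m) (Fin m) ℝ}
    (hskew : ∀ i, (B i).transpose = - B i) {U : Set (G m h)} (hUW : U ⊆ Wset m h)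
    {φ : G m h → ℝ} {j : Fin m} (hj : j ≠ 0) {T : ℝ} (hT : 0 ≤ T) {γ : ℝ → G m h}
    {grad : Fin m → ℝ} (hID : IDAt B U φ (γ 0) grad)
    (hU : ∀ t ∈ Set.Icc (0:ℝ) T, γ t ∈ U)
    (hγ : ∀ t ∈ Set.Icc (0:ℝ) T,
      HasDerivWithinAt γ (Dvec B φ j (γ t)) (Set.Icc (0:ℝ) T) t)
    {ε : ℝ} (hε : 0 < ε) :
    ∃ δ > (0:ℝ), ∀ t ∈ Set.Icc (0:ℝ) T, t < δ → ∀ M : ℝ,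
      (∀ s ∈ Set.Icc (0:ℝ) t, |φ (γ s) - φ (γ 0)| ≤ M) →
      |φ (γ t) - φ (γ 0) - grad j * t| ≤
        ε * (t + (∑ i, Real.sqrt |B i j 0|) * Real.sqrt (M * t)) := by
  have h0 : (0:ℝ) ∈ Set.Icc (0:ℝ) T := Set.left_mem_Icc.2 hT
  obtain ⟨r, hr, hb⟩ := hID ε hε
  have hlim : Tendsto (fun t => gdist B (γ 0) (γ t)) (𝓝[Set.Icc (0:ℝ) T] 0) (𝓝 0) := by
    have h1 := ((continuous_gdist B (γ 0)).continuousAt (x := γ 0)).tendsto.comp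
      (hγ 0 h0).continuousWithinAt
    rwa [gdist_self hskew] at h1
  obtain ⟨δ, hδ, hδr⟩ := Metric.mem_nhdsWithin_iff.1 (hlim.eventually_lt_const hr)
  refine ⟨δ, hδ, fun t ht htδ M hM => ?_⟩
  rcases ht.1.eq_or_lt with rfl | htpos
  · simp
  have hdist : gdist B (γ 0) (γ t) < r :=
    hδr ⟨by simpa [abs_of_pos htpos] using htδ, ht⟩
  have hfst := fst_integralCurve hγ ht
  have hpos : 0 < gdist B (γ 0) (γ t) := by
    refine lt_of_lt_of_le ?_ (abs_fst_sub_le_gdist B (γ 0) (γ t) j)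
    simpa [hfst] using htpos.ne'
  have hest := hb (γ t) (hU t ht) hpos hdist
  have hsum : ∑ k ∈ Finset.univ.erase (0 : Fin m), grad k * ((γ t).1 k - (γ 0).1 k)
      = grad j * t := by
    rw [Finset.sum_eq_single_of_mem j (by simp [hj])]
    · simp [hfst]
    · intro k _ hk
      simp [hfst, hk]
  rw [hsum] at hest
  exact hest.trans (mul_le_mul_of_nonneg_left
    (hnorm_shiftQ_integralCurve_le hskew (hUW (hU 0 h0)) hγ ht hM) hε.le)

theorem IDAt.hasDerivWithinAt_integralCurve [NeZero m]
    {B : Fin h → Matrix (Fin m) (Fin m) ℝ}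
    (hskew : ∀ i, (B i).transpose = - B i) {U : Set (G m h)} (hUW : U ⊆ Wset m h)
    {φ : G m h → ℝ} (hφ : ContinuousOn φ U) {j : Fin m} (hj : j ≠ 0) {T : ℝ} (hT : 0 ≤ T)
    {γ : ℝ → G m h} {grad : Fin m → ℝ} (hID : IDAt B U φ (γ 0) grad)
    (hU : ∀ t ∈ Set.Icc (0:ℝ) T, γ t ∈ U)
    (hγ : ∀ t ∈ Set.Icc (0:ℝ) T,
      HasDerivWithinAt γ (Dvec B φ j (γ t)) (Set.Icc (0:ℝ) T) t) :
    HasDerivWithinAt (fun t => φ (γ t)) (grad j) (Set.Icc (0:ℝ) T) 0 := by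
  set β := ∑ i, Real.sqrt |B i j 0| with hβ
  have hβ0 : 0 ≤ β := Finset.sum_nonneg fun i _ => Real.sqrt_nonneg _
  set K := 2 * |grad j| + 2 + β ^ 2 with hK
  have hK0 : 0 ≤ K := by positivity
  obtain ⟨δ₁, hδ₁, hfirst⟩ := hID.eventually_integralCurve hskew hUW hj hT hU hγ one_pos
  have hcont : ContinuousOn (fun t => |φ (γ t) - φ (γ 0)|) (Set.Icc (0:ℝ) T) :=
    ((hφ.comp (fun t ht => (hγ t ht).continuousWithinAt) hU).sub continuousOn_const).abs
  have hlip : ∀ t ∈ Set.Icc (0:ℝ) T, t < δ₁ →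
      ∀ s ∈ Set.Icc (0:ℝ) t, |φ (γ s) - φ (γ 0)| ≤ K * t := by
    intro t ht htδ
    obtain ⟨u, hu, humax⟩ := isCompact_Icc.exists_isMaxOn (Set.nonempty_Icc.2 ht.1)
      (hcont.mono (Set.Icc_subset_Icc_right ht.2))
    intro s hs
    refine (isMaxOn_iff.1 humax s hs).trans ?_
    have huT : u ∈ Set.Icc (0:ℝ) T := ⟨hu.1, hu.2.trans ht.2⟩
    have hest := hfirst u huT (hu.2.trans_lt htδ) |φ (γ u) - φ (γ 0)|
      (fun v hv => isMaxOn_iff.1 humax v ⟨hv.1, hv.2.trans hu.2⟩)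
    rw [← hβ, one_mul] at hest
    set M := |φ (γ u) - φ (γ 0)| with hM
    have hM0 : 0 ≤ M := abs_nonneg _
    have htri : M ≤ |φ (γ u) - φ (γ 0) - grad j * u| + |grad j| * u := by
      have := abs_add_le (φ (γ u) - φ (γ 0) - grad j * u) (grad j * u)
      rwa [sub_add_cancel, abs_mul, abs_of_nonneg hu.1] at this
    have hamgm : β * Real.sqrt (M * u) ≤ (M + β ^ 2 * u) / 2 := by
      rw [Real.sqrt_mul hM0]
      nlinarith [sq_nonneg (Real.sqrt M - β * Real.sqrt u), Real.sq_sqrt hM0,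
        Real.sq_sqrt hu.1]
    have hMu : M ≤ K * u := by
      rw [hK]
      linarith
    exact hMu.trans (mul_le_mul_of_nonneg_left hu.2 hK0)
  rw [hasDerivWithinAt_iff_isLittleO, Asymptotics.isLittleO_iff]
  intro c hc
  have hC : 0 < 1 + β * Real.sqrt K := by positivity
  obtain ⟨δ₂, hδ₂, hsecond⟩ :=
    hID.eventually_integralCurve hskew hUW hj hT hU hγ (div_pos hc hC)
  refine Metric.mem_nhdsWithin_iff.2 ⟨min δ₁ δ₂, lt_min hδ₁ hδ₂, fun t ht => ?_⟩
  obtain ⟨htball, htT⟩ := ht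
  have hlt : t < min δ₁ δ₂ := by
    simpa [abs_of_nonneg htT.1] using htball
  have hest := hsecond t htT (hlt.trans_le (min_le_right _ _)) (K * t)
    (hlip t htT (hlt.trans_le (min_le_left _ _)))
  have hsqrt : Real.sqrt (K * t * t) = Real.sqrt K * t := by
    rw [mul_assoc, Real.sqrt_mul hK0, Real.sqrt_mul_self htT.1]
  rw [← hβ, hsqrt] at hest
  have hfactor : c / (1 + β * Real.sqrt K) * (t + β * (Real.sqrt K * t)) = c * t := by
    field_simp
  rw [hfactor] at hest
  simpa [abs_of_nonneg htT.1, mul_comm t] using hest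

theorem IDAt.tendsto_vertical [NeZero m] {B : Fin h → Matrix (Fin m) (Fin m) ℝ}
    (hskew : ∀ i, (B i).transpose = - B i) {U : Set (G m h)} (hUopen : RelOpen m h U)
    {φ : G m h → ℝ} {w₀ : G m h} (hw₀ : w₀ ∈ U) {grad : Fin m → ℝ}
    (hID : IDAt B U φ w₀ grad) (i : Fin h) :
    Tendsto (fun t : ℝ => |φ (w₀ + t • eV m h i) - φ w₀| / Real.sqrt t)
      (𝓝[>] (0:ℝ)) (𝓝 0) := by
  have hU : ∀ᶠ t in 𝓝[>] (0:ℝ), w₀ + t • eV m h i ∈ U := by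
    obtain ⟨O, hO, rfl⟩ := hUopen
    have hc : Continuous fun t : ℝ => w₀ + t • eV m h i := by fun_prop
    have hmem : ∀ᶠ t in 𝓝 (0:ℝ), w₀ + t • eV m h i ∈ O :=
      hc.continuousAt.eventually_mem (hO.mem_nhds (by simpa using hw₀.1))
    filter_upwards [nhdsWithin_le_nhds hmem] with t ht
    refine ⟨ht, ?_⟩
    have h0 : w₀.1 0 = 0 := hw₀.2
    simp [Wset, eV, h0]
  have hsqrt : Tendsto Real.sqrt (𝓝[>] (0:ℝ)) (𝓝 0) := by
    have := Real.continuous_sqrt.tendsto 0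
    rw [Real.sqrt_zero] at this
    exact this.mono_left nhdsWithin_le_nhds
  rw [Metric.tendsto_nhds]
  intro ε hε
  obtain ⟨r, hr, hb⟩ := hID (ε / 2) (half_pos hε)
  filter_upwards [hU, self_mem_nhdsWithin, hsqrt.eventually_lt_const hr] with t htU ht htr
  have ht0 : 0 < t := ht
  have hst : 0 < Real.sqrt t := Real.sqrt_pos.2 ht0
  have hest := hb _ htU
  rw [gdist_vertical hskew w₀ i ht0.le, hnorm_shiftQ_vertical hskew φ w₀ i ht0.le] at hest
  have hest' := hest hst htr
  simp only [eV, Prod.fst_add, Prod.smul_fst, smul_zero, add_zero, sub_self, mul_zero,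
    Finset.sum_const_zero, sub_zero] at hest'
  rw [Real.dist_eq, sub_zero, abs_of_nonneg (by positivity), div_lt_iff₀ hst]
  refine lt_of_le_of_lt hest' ?_
  exact mul_lt_mul_of_pos_right (half_lt_self hε) hst

end Lemmas

/-- If `φ` is intrinsically differentiable at `w₀ ∈ U` with intrinsic
gradient `grad`, then (i) along every integral curve of `D^φ_j` starting at `w₀`, `φ∘γ` has
right derivative `grad j` at `0`, and (ii) `|φ(w₀ + t e_{y_i}) - φ(w₀)|/t^(1/2) → 0` as `t → 0⁺`. -/
theorem statement3 (m h : ℕ) [NeZero m] (hm : 2 ≤ m) (hh : 1 ≤ h)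
    (B : Fin h → Matrix (Fin m) (Fin m) ℝ)
    (hskew : ∀ i, (B i).transpose = - B i) (hBli : LinearIndependent ℝ B)
    (U : Set (G m h)) (hUW : U ⊆ Wset m h) (hUopen : RelOpen m h U)
    (φ : G m h → ℝ) (hφ : ContinuousOn φ U)
    (w₀ : G m h) (hw₀ : w₀ ∈ U) (grad : Fin m → ℝ) (hID : IDAt B U φ w₀ grad) :
    (∀ j : Fin m, j ≠ 0 → ∀ T : ℝ, 0 ≤ T → ∀ γ : ℝ → G m h,
        γ 0 = w₀ →
        (∀ t ∈ Set.Icc (0:ℝ) T, γ t ∈ U) →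
        (∀ t ∈ Set.Icc (0:ℝ) T, HasDerivWithinAt γ (Dvec B φ j (γ t)) (Set.Icc (0:ℝ) T) t) →
        HasDerivWithinAt (fun t => φ (γ t)) (grad j) (Set.Icc (0:ℝ) T) 0) ∧
    (∀ i : Fin h,
        Tendsto (fun t : ℝ => |φ (w₀ + t • eV m h i) - φ w₀| / Real.sqrt t)
          (𝓝[>] (0:ℝ)) (𝓝 0)) := by
  refine ⟨fun j hj T hT γ hγ0 hγU hγ => ?_, hID.tendsto_vertical hskew hUopen hw₀⟩
  subst hγ0
  exact hID.hasDerivWithinAt_integralCurve hskew hUW hφ hj hT hγU hγ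

end Step2
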